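/- arXiv:1711.08601 — 2 statements merged into one kernel-verified Lean document; each statement's English description precedes it below -/
import Mathlib

section
/- Let r_min = v_min/u_max and let 𝒯 = {(x,y,θ) ∈ ℝ³ : x = r_min·sin θ and y = −r_min·cos θ}. For every q₀ ∈ ℝ³, the set S = {T ≥ 0 : there exists an admissible trajectory q of the Dubins system on [0,T] with q(0) = q₀ and q(T) ∈ 𝒯} is nonempty, and its infimum is attained: there exists an admissible trajectory on [0, inf S] joining q₀ to a point of 𝒯 (existence of a time-optimal trajectory to the target). -/
open MeasureTheory Set

noncomputable section

/-- An admissible trajectory of the Dubins system on `[0, T]`. -/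
def DubinsTraj (umax vmin vmax T : ℝ) (x y θ : ℝ → ℝ) (u v : ℝ → ℝ) : Prop :=
  Measurable u ∧ Measurable v ∧
  (∀ᵐ t ∂volume, t ∈ Icc (0 : ℝ) T → u t ∈ Icc (-umax) umax ∧ v t ∈ Icc vmin vmax) ∧
  (∃ K, LipschitzOnWith K (fun t => (x t, y t, θ t)) (Icc (0 : ℝ) T)) ∧
  (∀ᵐ t ∂volume, t ∈ Icc (0 : ℝ) T →
    HasDerivWithinAt x (v t * Real.cos (θ t)) (Icc (0 : ℝ) T) t ∧
    HasDerivWithinAt y (v t * Real.sin (θ t)) (Icc (0 : ℝ) T) t ∧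
    HasDerivWithinAt θ (u t) (Icc (0 : ℝ) T) t)

/-- The set of times `T ≥ 0` for which some admissible trajectory joins `q₀` to the
target circle `𝒯 = {x = r_min sin θ, y = -r_min cos θ}` where `r_min = vmin / umax`. -/
def DubinsReachTimes (umax vmin vmax : ℝ) (q₀ : ℝ × ℝ × ℝ) : Set ℝ :=
  {T | 0 ≤ T ∧ ∃ x y θ u v : ℝ → ℝ,
    DubinsTraj umax vmin vmax T x y θ u v ∧
    (x 0, y 0, θ 0) = q₀ ∧
    x T = (vmin / umax) * Real.sin (θ T) ∧ y T = -((vmin / umax) * Real.cos (θ T))}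

open Filter Topology

/-- Relaxed (integrated) trajectories, defined on all of `ℝ`, with arc length `s`. -/
structure DubinsRelax (umax vmin vmax : ℝ) (x y θ s : ℝ → ℝ) : Prop where
  hθ : ∀ p q, |θ q - θ p| ≤ umax * |q - p|
  hs : ∀ p q, p ≤ q → vmin * (q - p) ≤ s q - s p ∧ s q - s p ≤ vmax * (q - p)
  hx : ∀ p q, |x q - x p - Real.cos (θ p) * (s q - s p)| ≤ umax * vmax * (q - p) ^ 2
  hy : ∀ p q, |y q - y p - Real.sin (θ p) * (s q - s p)| ≤ umax * vmax * (q - p) ^ 2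

lemma dubins_s_abs {vmin vmax : ℝ} (hvmin : 0 < vmin) {s : ℝ → ℝ}
    (hs : ∀ p q, p ≤ q → vmin * (q - p) ≤ s q - s p ∧ s q - s p ≤ vmax * (q - p)) (p q : ℝ) :
    |s q - s p| ≤ vmax * |q - p| := by
  rcases le_total p q with h | h
  · have h1 := hs p q h
    have h2 : 0 ≤ vmin * (q - p) := mul_nonneg hvmin.le (sub_nonneg.2 h)
    rw [abs_of_nonneg (sub_nonneg.2 h), abs_of_nonneg (h2.trans h1.1)]
    exact h1.2
  · have h1 := hs q p h
    have h2 : 0 ≤ vmin * (p - q) := mul_nonneg hvmin.le (sub_nonneg.2 h)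
    rw [abs_sub_comm, abs_sub_comm q p, abs_of_nonneg (sub_nonneg.2 h),
      abs_of_nonneg (h2.trans h1.1)]
    exact h1.2

lemma dubins_x_abs {vmin vmax C : ℝ} (hvmin : 0 < vmin) {x c s : ℝ → ℝ}
    (hs : ∀ p q, p ≤ q → vmin * (q - p) ≤ s q - s p ∧ s q - s p ≤ vmax * (q - p))
    (hc : ∀ p, |c p| ≤ 1)
    (hx : ∀ p q, |x q - x p - c p * (s q - s p)| ≤ C * (q - p) ^ 2) (p q : ℝ) :
    |x q - x p| ≤ vmax * |q - p| + C * (q - p) ^ 2 := by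
  have h1 := hx p q
  have h2 := dubins_s_abs hvmin hs p q
  have h3 : |c p * (s q - s p)| ≤ |s q - s p| := by
    rw [abs_mul]; exact mul_le_of_le_one_left (abs_nonneg _) (hc p)
  have h4 : |x q - x p| ≤ |x q - x p - c p * (s q - s p)| + |c p * (s q - s p)| := by
    have := abs_add_le (x q - x p - c p * (s q - s p)) (c p * (s q - s p))
    simpa using this
  linarith

lemma dubins_hasDeriv {C t w k : ℝ} {x s : ℝ → ℝ} (hsd : HasDerivAt s w t)
    (hx : ∀ q, |x q - x t - k * (s q - s t)| ≤ C * (q - t) ^ 2) :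
    HasDerivAt x (w * k) t := by
  have h0 : HasDerivAt (fun q => x q - k * s q) 0 t := by
    rw [hasDerivAt_iff_isLittleO]
    have hO : (fun q => x q - k * s q - (x t - k * s t) - (q - t) • (0 : ℝ)) =O[𝓝 t]
        fun q => (q - t) ^ 2 := by
      refine Asymptotics.IsBigO.of_bound C (Eventually.of_forall fun q => ?_)
      have := hx q
      rw [Real.norm_eq_abs, Real.norm_eq_abs, abs_of_nonneg (sq_nonneg (q - t))]
      convert this using 2
      simp; ring
    refine hO.trans_isLittleO ?_
    have h1 : (fun q : ℝ => q - t) =o[𝓝 t] fun _ => (1 : ℝ) := by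
      rw [Asymptotics.isLittleO_one_iff]
      have : Continuous fun q : ℝ => q - t := by fun_prop
      simpa using this.tendsto t
    have h2 := h1.mul_isBigO (Asymptotics.isBigO_refl (fun q : ℝ => q - t) (𝓝 t))
    simpa [sq] using h2
  have h1 := h0.add (hsd.const_mul k)
  have h2 : (fun q => x q - k * s q) + (fun q => k * s q) = x := by ext q; simp
  rw [zero_add, mul_comm] at h1
  rw [h2] at h1
  exact h1

lemma dubins_ae_diff {C : ℝ} {f : ℝ → ℝ} (hf : ∀ p q, |f q - f p| ≤ C * |q - p|) :
    ∀ᵐ t, DifferentiableAt ℝ f t := by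
  have : LipschitzWith (Real.toNNReal C) f := by
    refine LipschitzWith.of_dist_le_mul fun p q => ?_
    rw [Real.dist_eq, Real.dist_eq]
    refine (hf q p).trans ?_
    gcongr
    exact Real.le_coe_toNNReal C
  exact this.ae_differentiableAt_real

lemma DubinsRelax.traj {umax vmin vmax : ℝ} (humax : 0 < umax) (hvmin : 0 < vmin)
    (hv : vmin ≤ vmax) {x y θ s : ℝ → ℝ} (h : DubinsRelax umax vmin vmax x y θ s) (T : ℝ) :
    DubinsTraj umax vmin vmax T x y θ (deriv θ) (deriv s) := by
  have hsl := dubins_s_abs hvmin h.hs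
  have hxl := dubins_x_abs hvmin h.hs (fun p => Real.abs_cos_le_one (θ p)) h.hx
  have hyl := dubins_x_abs hvmin h.hs (fun p => Real.abs_sin_le_one (θ p)) h.hy
  have hvmax : 0 < vmax := hvmin.trans_le hv
  refine ⟨measurable_deriv θ, measurable_deriv s, ?_, ?_, ?_⟩
  · filter_upwards [dubins_ae_diff h.hθ, dubins_ae_diff hsl] with t h1 h2 _
    refine ⟨?_, ?_⟩
    · have h3 := h1.hasDerivAt.le_of_lipschitz (C := Real.toNNReal umax) (by
        refine LipschitzWith.of_dist_le_mul fun p q => ?_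
        rw [Real.dist_eq, Real.dist_eq, Real.coe_toNNReal _ humax.le]
        exact h.hθ q p)
      rw [Real.coe_toNNReal _ humax.le, Real.norm_eq_abs] at h3
      exact abs_le.1 h3
    · have h3 := h2.hasDerivAt.tendsto_slope
      have h4 : ∀ᶠ q in 𝓝[≠] t, slope s t q ∈ Icc vmin vmax := by
        filter_upwards [self_mem_nhdsWithin] with q hq
        rw [slope_def_field]
        rcases lt_or_gt_of_ne hq with hq | hq
        · have := h.hs q t hq.le
          rw [← neg_div_neg_eq, neg_sub, neg_sub]
          exact ⟨(le_div_iff₀ (sub_pos.2 hq)).2 this.1, (div_le_iff₀ (sub_pos.2 hq)).2 this.2⟩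
        · have := h.hs t q hq.le
          exact ⟨(le_div_iff₀ (sub_pos.2 hq)).2 this.1, (div_le_iff₀ (sub_pos.2 hq)).2 this.2⟩
      exact isClosed_Icc.mem_of_tendsto h3 h4
  · have aux : ∀ f : ℝ → ℝ, (∀ p q, |f q - f p| ≤ vmax * |q - p| + umax * vmax * (q - p) ^ 2) →
        LipschitzOnWith (Real.toNNReal (vmax + umax * vmax * |T|)) f (Icc 0 T) := by
      intro f hf
      refine LipschitzOnWith.of_dist_le_mul fun p hp q hq => ?_
      rw [Real.dist_eq, Real.dist_eq, Real.coe_toNNReal _ (by positivity)]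
      refine (hf q p).trans ?_
      have h1 : |p - q| ≤ |T| := by
        rw [abs_le]
        have := le_abs_self T
        constructor <;> linarith [hp.1, hp.2, hq.1, hq.2]
      rw [← sq_abs, sq, add_mul, mul_assoc (umax * vmax)]
      gcongr
    have hθ : LipschitzOnWith (Real.toNNReal umax) θ (Icc 0 T) := by
      refine LipschitzOnWith.of_dist_le_mul fun p _ q _ => ?_
      rw [Real.dist_eq, Real.dist_eq, Real.coe_toNNReal _ humax.le]
      exact h.hθ q p
    exact ⟨_, (aux x hxl).prodMk ((aux y hyl).prodMk hθ)⟩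
  · filter_upwards [dubins_ae_diff h.hθ, dubins_ae_diff hsl] with t h1 h2 _
    exact ⟨(dubins_hasDeriv h2.hasDerivAt (h.hx t)).hasDerivWithinAt,
      (dubins_hasDeriv h2.hasDerivAt (h.hy t)).hasDerivWithinAt, h1.hasDerivAt.hasDerivWithinAt⟩

/-- Integrals of bounded measurable functions. -/
lemma dubins_intble {f : ℝ → ℝ} {B : ℝ} (hf : Measurable f) (hB : ∀ t, |f t| ≤ B) (p q : ℝ) :
    IntervalIntegrable f volume p q := by
  refine (intervalIntegrable_const (c := B)).mono_fun hf.aestronglyMeasurable ?_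
  refine Eventually.of_forall fun t => ?_
  exact (hB t).trans (le_abs_self B)

lemma dubins_int_bound {f : ℝ → ℝ} {B : ℝ} (hB : ∀ t, |f t| ≤ B) (p q : ℝ) :
    |∫ τ in p..q, f τ| ≤ B * |q - p| := by
  simpa using intervalIntegral.norm_integral_le_of_norm_le_const (a := p) (b := q)
    (f := f) (C := B) (fun t _ => hB t)

lemma dubins_relax_x {umax vmax : ℝ} {w θ : ℝ → ℝ} {c : ℝ → ℝ} (humax : 0 ≤ umax)
    (hvmax : 0 ≤ vmax)
    (hc : Continuous c) (hc1 : ∀ p, |c p| ≤ 1) (hcl : ∀ p q, |c p - c q| ≤ |p - q|)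
    (hw : Measurable w) (hwB : ∀ t, |w t| ≤ vmax)
    (hθ : ∀ p q, |θ q - θ p| ≤ umax * |q - p|) (hθc : Continuous θ) (x0 p q : ℝ) :
    |(x0 + ∫ τ in (0:ℝ)..q, w τ * c (θ τ)) - (x0 + ∫ τ in (0:ℝ)..p, w τ * c (θ τ))
      - c (θ p) * ((∫ τ in (0:ℝ)..q, w τ) - ∫ τ in (0:ℝ)..p, w τ)|
      ≤ umax * vmax * (q - p) ^ 2 := by
  have hm : Measurable fun τ => w τ * c (θ τ) := hw.mul (hc.comp hθc).measurable
  have hmB : ∀ τ, |w τ * c (θ τ)| ≤ vmax := fun τ => by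
    rw [abs_mul]
    calc _ ≤ vmax * 1 := mul_le_mul (hwB τ) (hc1 _) (abs_nonneg _) hvmax
      _ = vmax := mul_one _
  have hI := dubins_intble hm hmB
  have hJ := dubins_intble hw hwB
  rw [add_sub_add_left_eq_sub, intervalIntegral.integral_interval_sub_left (hI _ _) (hI _ _),
    intervalIntegral.integral_interval_sub_left (hJ _ _) (hJ _ _),
    ← intervalIntegral.integral_const_mul,
    ← intervalIntegral.integral_sub (hI _ _) ((hJ _ _).const_mul _)]
  have key : ∀ τ ∈ uIoc p q, ‖w τ * c (θ τ) - c (θ p) * w τ‖ ≤ umax * vmax * |q - p| := by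
    intro τ hτ
    have h1 : |τ - p| ≤ |q - p| := by
      apply abs_sub_left_of_mem_uIcc
      exact uIoc_subset_uIcc hτ
    have : w τ * c (θ τ) - c (θ p) * w τ = w τ * (c (θ τ) - c (θ p)) := by ring
    rw [this, Real.norm_eq_abs, abs_mul]
    calc |w τ| * |c (θ τ) - c (θ p)| ≤ vmax * (umax * |q - p|) := by
          refine mul_le_mul (hwB τ) ?_ (abs_nonneg _) hvmax
          refine (hcl _ _).trans ((hθ p τ).trans ?_)
          gcongr
      _ = _ := by ring
  have := intervalIntegral.norm_integral_le_of_norm_le_const key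
  rw [Real.norm_eq_abs] at this
  refine this.trans (le_of_eq ?_)
  rw [← sq_abs (q - p)]; ring

lemma dubins_of_controls {umax vmin vmax : ℝ} (humax : 0 < umax) (hvmin : 0 < vmin)
    (hv : vmin ≤ vmax) {u v : ℝ → ℝ} (hum : Measurable u) (hvm : Measurable v)
    (hu : ∀ t, u t ∈ Icc (-umax) umax) (hvv : ∀ t, v t ∈ Icc vmin vmax) (x0 y0 θ0 : ℝ) :
    ∃ θ : ℝ → ℝ, (θ = fun t => θ0 + ∫ τ in (0:ℝ)..t, u τ) ∧
      DubinsRelax umax vmin vmax (fun t => x0 + ∫ τ in (0:ℝ)..t, v τ * Real.cos (θ τ))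
        (fun t => y0 + ∫ τ in (0:ℝ)..t, v τ * Real.sin (θ τ)) θ
        (fun t => ∫ τ in (0:ℝ)..t, v τ) := by
  have huB : ∀ t, |u t| ≤ umax := fun t => abs_le.2 (hu t)
  have hvmax : 0 < vmax := hvmin.trans_le hv
  have hvB : ∀ t, |v t| ≤ vmax := fun t => by
    rw [abs_of_nonneg (hvmin.le.trans (hvv t).1)]; exact (hvv t).2
  have hI := dubins_intble hum huB
  have hJ := dubins_intble hvm hvB
  refine ⟨_, rfl, ?_⟩
  have hθ : ∀ p q, |(θ0 + ∫ τ in (0:ℝ)..q, u τ) - (θ0 + ∫ τ in (0:ℝ)..p, u τ)|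
      ≤ umax * |q - p| := by
    intro p q
    rw [add_sub_add_left_eq_sub, intervalIntegral.integral_interval_sub_left (hI _ _) (hI _ _)]
    exact dubins_int_bound huB p q
  have hθc : Continuous fun t => θ0 + ∫ τ in (0:ℝ)..t, u τ := by
    refine continuous_const.add ?_
    exact intervalIntegral.continuous_primitive (fun a b => hI a b) 0
  refine ⟨hθ, ?_, ?_, ?_⟩
  · intro p q hpq
    rw [intervalIntegral.integral_interval_sub_left (hJ _ _) (hJ _ _)]
    constructor
    · have := intervalIntegral.integral_mono hpq (intervalIntegrable_const (c := vmin)) (hJ p q)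
        (fun t => (hvv t).1)
      simpa [mul_comm] using this
    · have := intervalIntegral.integral_mono hpq (hJ p q) (intervalIntegrable_const (c := vmax))
        (fun t => (hvv t).2)
      simpa [mul_comm] using this
  · intro p q
    exact dubins_relax_x (c := Real.cos) humax.le hvmax.le Real.continuous_cos
      Real.abs_cos_le_one Real.abs_cos_sub_cos_le hvm hvB hθ hθc x0 p q
  · intro p q
    exact dubins_relax_x (c := Real.sin) humax.le hvmax.le Real.continuous_sin
      Real.abs_sin_le_one Real.abs_sin_sub_sin_le hvm hvB hθ hθc y0 p q

lemma dubins_ftc {T : ℝ} {f g : ℝ → ℝ} {K : NNReal} (hf : LipschitzOnWith K f (Icc 0 T))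
    (hd : ∀ᵐ t ∂volume, t ∈ Icc (0 : ℝ) T → HasDerivWithinAt f (g t) (Icc 0 T) t) {t : ℝ}
    (ht : t ∈ Icc 0 T) : f t = f 0 + ∫ τ in (0:ℝ)..t, g τ := by
  have hl : LipschitzOnWith K f (uIcc 0 t) := by
    rw [uIcc_of_le ht.1]; exact hf.mono (Icc_subset_Icc_right ht.2)
  have h1 := hl.absolutelyContinuousOnInterval.integral_deriv_eq_sub
  have h2 : ∫ τ in (0:ℝ)..t, deriv f τ = ∫ τ in (0:ℝ)..t, g τ := by
    refine intervalIntegral.integral_congr_ae ?_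
    have hne : ∀ᵐ τ : ℝ, τ ≠ T := by simp [ae_iff]
    filter_upwards [hd, hne] with τ h3 h4 h5
    rw [uIoc_of_le ht.1] at h5
    have h6 : τ < T := lt_of_le_of_ne (h5.2.trans ht.2) h4
    exact ((h3 ⟨h5.1.le, h6.le⟩).hasDerivAt (Icc_mem_nhds h5.1 h6)).deriv
  rw [← h2, h1]; ring

lemma dubins_traj_relax {umax vmin vmax : ℝ} (humax : 0 < umax) (hvmin : 0 < vmin)
    (hv : vmin ≤ vmax) {T : ℝ} (hT : 0 ≤ T) {x y θ u v : ℝ → ℝ}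
    (h : DubinsTraj umax vmin vmax T x y θ u v) :
    ∃ x' y' θ' s' : ℝ → ℝ, DubinsRelax umax vmin vmax x' y' θ' s' ∧ s' 0 = 0 ∧
      x' 0 = x 0 ∧ y' 0 = y 0 ∧ θ' 0 = θ 0 ∧ x' T = x T ∧ y' T = y T ∧ θ' T = θ T := by
  obtain ⟨hum, hvm, hb, ⟨K, hK⟩, hd⟩ := h
  let u' : ℝ → ℝ := fun t => max (-umax) (min umax (u t))
  let v' : ℝ → ℝ := fun t => max vmin (min vmax (v t))
  have hum' : Measurable u' := measurable_const.max (measurable_const.min hum)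
  have hvm' : Measurable v' := measurable_const.max (measurable_const.min hvm)
  have hu' : ∀ t, u' t ∈ Icc (-umax) umax := fun t =>
    ⟨le_max_left _ _, max_le (by linarith) (min_le_left _ _)⟩
  have hv' : ∀ t, v' t ∈ Icc vmin vmax := fun t =>
    ⟨le_max_left _ _, max_le hv (min_le_left _ _)⟩
  have hue : ∀ t, u t ∈ Icc (-umax) umax → u' t = u t := fun t ht => by
    simp only [u']; rw [min_eq_right ht.2, max_eq_right ht.1]
  have hve : ∀ t, v t ∈ Icc vmin vmax → v' t = v t := fun t ht => by
    simp only [v']; rw [min_eq_right ht.2, max_eq_right ht.1]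
  obtain ⟨θ', hθ', hR⟩ := dubins_of_controls humax hvmin hv hum' hvm' hu' hv' (x 0) (y 0) (θ 0)
  have hKx : LipschitzOnWith K x (Icc 0 T) := by
    simpa using! LipschitzWith.prod_fst.comp_lipschitzOnWith hK
  have hKy : LipschitzOnWith K y (Icc 0 T) := by
    simpa using! (LipschitzWith.prod_fst.comp LipschitzWith.prod_snd).comp_lipschitzOnWith hK
  have hKθ : LipschitzOnWith K θ (Icc 0 T) := by
    simpa using! (LipschitzWith.prod_snd.comp LipschitzWith.prod_snd).comp_lipschitzOnWith hK
  have eθ : ∀ t ∈ Icc 0 T, θ' t = θ t := by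
    intro t ht
    rw [hθ']
    refine (dubins_ftc hKθ ?_ ht).symm
    filter_upwards [hb, hd] with τ h1 h2 h3
    rw [hue τ (h1 h3).1]
    exact (h2 h3).2.2
  have ex : ∀ t ∈ Icc 0 T, x t = x 0 + ∫ τ in (0:ℝ)..t, v' τ * Real.cos (θ' τ) := by
    intro t ht
    refine dubins_ftc hKx ?_ ht
    filter_upwards [hb, hd] with τ h1 h2 h3
    rw [hve τ (h1 h3).2, eθ τ h3]
    exact (h2 h3).1
  have ey : ∀ t ∈ Icc 0 T, y t = y 0 + ∫ τ in (0:ℝ)..t, v' τ * Real.sin (θ' τ) := by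
    intro t ht
    refine dubins_ftc hKy ?_ ht
    filter_upwards [hb, hd] with τ h1 h2 h3
    rw [hve τ (h1 h3).2, eθ τ h3]
    exact (h2 h3).2.1
  have h0 : (0:ℝ) ∈ Icc 0 T := ⟨le_rfl, hT⟩
  have h1 : T ∈ Icc 0 T := ⟨hT, le_rfl⟩
  exact ⟨_, _, _, _, hR, by simp, (ex 0 h0).symm, (ey 0 h0).symm, eθ 0 h0, (ex T h1).symm,
    (ey T h1).symm, eθ T h1⟩

lemma dubins_ulim (f : ℕ → ℝ → ℝ) (x0 : ℝ) (B : ℝ → ℝ) (h : ∀ n t, |f n t - x0| ≤ B t) :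
    ∃ g : ℝ → ℝ, ∀ t, Tendsto (fun n => f n t) (hyperfilter ℕ) (𝓝 (g t)) := by
  have : ∀ t, ∃ l, Tendsto (fun n => f n t) (hyperfilter ℕ) (𝓝 l) := by
    intro t
    have hc : IsCompact (Icc (x0 - B t) (x0 + B t)) := isCompact_Icc
    obtain ⟨l, _, hl⟩ := hc.ultrafilter_le_nhds ((hyperfilter ℕ).map fun n => f n t) (by
      rw [le_principal_iff]
      refine Filter.mem_map.2 (Eventually.of_forall fun n => ?_)
      have := abs_le.1 (h n t)
      constructor <;> linarith)
    exact ⟨l, hl⟩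
  choose g hg using this
  exact ⟨g, hg⟩

lemma dubins_eval {F : Filter ℕ} {f : ℕ → ℝ → ℝ} {g : ℝ → ℝ} {A C T : ℝ} {Tn : ℕ → ℝ}
    (hT : Tendsto Tn F (𝓝 T)) (hg : Tendsto (fun n => f n T) F (𝓝 (g T)))
    (hf : ∀ n p q, |f n q - f n p| ≤ A * |q - p| + C * (q - p) ^ 2) :
    Tendsto (fun n => f n (Tn n)) F (𝓝 (g T)) := by
  have h0 : Tendsto (fun n => A * |Tn n - T| + C * (Tn n - T) ^ 2) F (𝓝 0) := by
    have hc : Continuous fun r : ℝ => A * |r - T| + C * (r - T) ^ 2 := by fun_prop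
    have := (hc.tendsto T).comp hT
    simpa using! this
  have h1 : Tendsto (fun n => f n (Tn n) - f n T) F (𝓝 0) :=
    squeeze_zero_norm (fun n => hf n T (Tn n)) h0
  simpa using hg.add h1

lemma dubins_closed {umax vmin vmax : ℝ} (humax : 0 < umax) (hvmin : 0 < vmin)
    (hv : vmin ≤ vmax) (q₀ : ℝ × ℝ × ℝ) {Tn : ℕ → ℝ} {T : ℝ}
    (hTn : ∀ n, Tn n ∈ DubinsReachTimes umax vmin vmax q₀) (hT : Tendsto Tn atTop (𝓝 T)) :
    T ∈ DubinsReachTimes umax vmin vmax q₀ := by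
  have hT0 : 0 ≤ T := ge_of_tendsto' hT fun n => (hTn n).1
  have key : ∀ n, ∃ x y θ s : ℝ → ℝ, DubinsRelax umax vmin vmax x y θ s ∧ s 0 = 0 ∧
      (x 0, y 0, θ 0) = q₀ ∧ x (Tn n) = (vmin / umax) * Real.sin (θ (Tn n)) ∧
      y (Tn n) = -((vmin / umax) * Real.cos (θ (Tn n))) := by
    intro n
    obtain ⟨h0, x, y, θ, u, v, hD, hq, hx, hy⟩ := hTn n
    obtain ⟨x', y', θ', s', hR, e0, e1, e2, e3, e4, e5, e6⟩ :=
      dubins_traj_relax humax hvmin hv h0 hD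
    exact ⟨x', y', θ', s', hR, e0, by rw [e1, e2, e3, hq], by rw [e4, e6, hx],
      by rw [e5, e6, hy]⟩
  choose x y θ s hR hs0 hq hxT hyT using key
  have hx0 : ∀ n, x n 0 = q₀.1 := fun n => by rw [← hq n]
  have hy0 : ∀ n, y n 0 = q₀.2.1 := fun n => by rw [← hq n]
  have hθ0 : ∀ n, θ n 0 = q₀.2.2 := fun n => by rw [← hq n]
  have hsl := fun n => dubins_s_abs hvmin (hR n).hs
  have hxl := fun n => dubins_x_abs hvmin (hR n).hs
    (fun p => Real.abs_cos_le_one (θ n p)) (hR n).hx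
  have hyl := fun n => dubins_x_abs hvmin (hR n).hs
    (fun p => Real.abs_sin_le_one (θ n p)) (hR n).hy
  obtain ⟨X, hX⟩ := dubins_ulim x q₀.1 _ (fun n t => by rw [← hx0 n]; exact hxl n 0 t)
  obtain ⟨Y, hY⟩ := dubins_ulim y q₀.2.1 _ (fun n t => by rw [← hy0 n]; exact hyl n 0 t)
  obtain ⟨Θ, hΘ⟩ := dubins_ulim θ q₀.2.2 _ (fun n t => by rw [← hθ0 n]; exact (hR n).hθ 0 t)
  obtain ⟨S, hS⟩ := dubins_ulim s 0 _ (fun n t => by rw [← hs0 n]; exact hsl n 0 t)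
  have hRel : DubinsRelax umax vmin vmax X Y Θ S := by
    refine ⟨fun p q => ?_, fun p q hpq => ⟨?_, ?_⟩, fun p q => ?_, fun p q => ?_⟩
    · exact le_of_tendsto' ((hΘ q).sub (hΘ p)).abs fun n => (hR n).hθ p q
    · exact ge_of_tendsto' ((hS q).sub (hS p)) fun n => ((hR n).hs p q hpq).1
    · exact le_of_tendsto' ((hS q).sub (hS p)) fun n => ((hR n).hs p q hpq).2
    · exact le_of_tendsto' (((hX q).sub (hX p)).sub
        (((Real.continuous_cos.tendsto _).comp (hΘ p)).mul ((hS q).sub (hS p)))).abs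
        fun n => (hR n).hx p q
    · exact le_of_tendsto' (((hY q).sub (hY p)).sub
        (((Real.continuous_sin.tendsto _).comp (hΘ p)).mul ((hS q).sub (hS p)))).abs
        fun n => (hR n).hy p q
  have hTu : Tendsto Tn (hyperfilter ℕ) (𝓝 T) := hT.mono_left Nat.hyperfilter_le_atTop
  have eX := dubins_eval hTu (hX T) hxl
  have eY := dubins_eval hTu (hY T) hyl
  have eΘ := dubins_eval (C := 0) hTu (hΘ T) (fun n p q => by simpa using (hR n).hθ p q)
  refine ⟨hT0, X, Y, Θ, _, _, hRel.traj humax hvmin hv T, ?_, ?_, ?_⟩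
  · have a1 : X 0 = q₀.1 := tendsto_nhds_unique (hX 0) (by simp [hx0])
    have a2 : Y 0 = q₀.2.1 := tendsto_nhds_unique (hY 0) (by simp [hy0])
    have a3 : Θ 0 = q₀.2.2 := tendsto_nhds_unique (hΘ 0) (by simp [hθ0])
    rw [a1, a2, a3]
  · refine tendsto_nhds_unique eX ?_
    simp only [hxT]
    exact ((Real.continuous_sin.tendsto _).comp eΘ).const_mul _
  · refine tendsto_nhds_unique eY ?_
    simp only [hyT]
    exact (((Real.continuous_cos.tendsto _).comp eΘ).const_mul _).neg

lemma dubins_angle (a b θ0 : ℝ) : ∃ φ R : ℝ, θ0 ≤ φ ∧ 0 ≤ R ∧ a + R * Real.cos φ = 0 ∧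
    b + R * Real.sin φ = 0 := by
  let z : ℂ := ⟨-a, -b⟩
  obtain ⟨k, hk⟩ := exists_nat_ge ((θ0 - z.arg) / (2 * Real.pi))
  refine ⟨z.arg + k * (2 * Real.pi), ‖z‖, ?_, norm_nonneg _, ?_, ?_⟩
  · rw [div_le_iff₀ (by positivity)] at hk
    linarith
  · rw [Real.cos_add_nat_mul_two_pi, Complex.norm_mul_cos_arg]; simp [z]
  · rw [Real.sin_add_nat_mul_two_pi, Complex.norm_mul_sin_arg]; simp [z]

lemma dubins_nonempty {umax vmin vmax : ℝ} (humax : 0 < umax) (hvmin : 0 < vmin)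
    (hv : vmin ≤ vmax) (q₀ : ℝ × ℝ × ℝ) : (DubinsReachTimes umax vmin vmax q₀).Nonempty := by
  obtain ⟨x0, y0, θ0⟩ := q₀
  set r := vmin / umax with hr
  have hru : r * umax = vmin := div_mul_cancel₀ _ humax.ne'
  obtain ⟨φ, R, hφ, hR, hc1, hc2⟩ :=
    dubins_angle (x0 - r * Real.sin θ0) (y0 + r * Real.cos θ0) θ0
  set t1 := (φ - θ0) / umax with ht1
  have ht1e : umax * t1 = φ - θ0 := mul_div_cancel₀ _ humax.ne'
  have ht10 : 0 ≤ t1 := div_nonneg (by linarith) humax.le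
  set t2 := R / vmin with ht2
  have ht2e : vmin * t2 = R := mul_div_cancel₀ _ hvmin.ne'
  have ht20 : 0 ≤ t2 := div_nonneg hR hvmin.le
  let m : ℝ → ℝ := fun t => min t t1
  let M : ℝ → ℝ := fun t => max (t - t1) 0
  let θ : ℝ → ℝ := fun t => θ0 + umax * m t
  let x : ℝ → ℝ := fun t => (x0 - r * Real.sin θ0) + r * Real.sin (θ t) + vmin * Real.cos φ * M t
  let y : ℝ → ℝ := fun t => (y0 + r * Real.cos θ0) - r * Real.cos (θ t) + vmin * Real.sin φ * M t
  have hm : LipschitzWith 1 m := LipschitzWith.id.min_const t1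
  have hM : LipschitzWith 1 M := by
    have : LipschitzWith 1 fun t : ℝ => t - t1 := by
      refine LipschitzWith.of_dist_le_mul fun p q => ?_
      simp
    exact this.max_const 0
  have hcm : ∀ (k : ℝ) {K : NNReal} {f : ℝ → ℝ}, LipschitzWith K f →
      LipschitzWith (‖k‖₊ * K) fun t => k * f t := by
    intro k K f hf
    refine LipschitzWith.of_dist_le_mul fun p q => ?_
    have := hf.dist_le_mul p q
    rw [Real.dist_eq, ← mul_sub, abs_mul, ← Real.dist_eq]
    push_cast
    rw [mul_assoc, Real.norm_eq_abs]
    gcongr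
  have hθl := (LipschitzWith.const θ0).add (hcm umax hm)
  have hxl := ((LipschitzWith.const (x0 - r * Real.sin θ0)).add
    (hcm r (Real.lipschitzWith_sin.comp hθl))).add (hcm (vmin * Real.cos φ) hM)
  have hyl := ((LipschitzWith.const (y0 + r * Real.cos θ0)).sub
    (hcm r (Real.lipschitzWith_cos.comp hθl))).add (hcm (vmin * Real.sin φ) hM)
  refine ⟨t1 + t2, add_nonneg ht10 ht20, x, y, θ, fun t => if t < t1 then umax else 0,
    fun _ => vmin, ⟨?_, measurable_const, ?_, ?_, ?_⟩, ?_, ?_, ?_⟩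
  · exact Measurable.ite measurableSet_Iio measurable_const measurable_const
  · refine Eventually.of_forall fun t _ => ⟨?_, le_rfl, hv⟩
    dsimp only
    split_ifs
    · exact ⟨by linarith, le_rfl⟩
    · exact ⟨by linarith, humax.le⟩
  · exact ⟨_, ((hxl.prodMk (hyl.prodMk hθl)).lipschitzOnWith (s := Icc 0 (t1 + t2)))⟩
  · have hne : ∀ᵐ τ : ℝ, τ ≠ t1 := by simp [ae_iff]
    filter_upwards [hne] with t ht _
    rcases lt_or_gt_of_ne ht with h | h
    · have em : HasDerivAt m 1 t := by
        refine (hasDerivAt_id t).congr_of_eventuallyEq ?_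
        filter_upwards [Iio_mem_nhds h] with τ hτ
        exact min_eq_left (le_of_lt hτ)
      have eM : HasDerivAt M 0 t := by
        refine (hasDerivAt_const t (0:ℝ)).congr_of_eventuallyEq ?_
        filter_upwards [Iio_mem_nhds h] with τ hτ
        exact max_eq_right (sub_nonpos.2 (le_of_lt hτ))
      have eθ : HasDerivAt θ umax t := by
        have := (em.const_mul umax).const_add θ0
        rw [mul_one] at this
        exact this
      rw [if_pos h]
      refine ⟨HasDerivAt.hasDerivWithinAt ?_, HasDerivAt.hasDerivWithinAt ?_,
        eθ.hasDerivWithinAt⟩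
      · convert! ((eθ.sin.const_mul r).const_add (x0 - r * Real.sin θ0)).add
          (eM.const_mul (vmin * Real.cos φ)) using 1
        rw [← hru]; ring
      · convert! ((eθ.cos.const_mul r).const_sub (y0 + r * Real.cos θ0)).add
          (eM.const_mul (vmin * Real.sin φ)) using 1
        rw [← hru]; ring
    · have em : HasDerivAt m 0 t := by
        refine (hasDerivAt_const t t1).congr_of_eventuallyEq ?_
        filter_upwards [Ioi_mem_nhds h] with τ hτ
        exact min_eq_right (le_of_lt hτ)
      have eM : HasDerivAt M 1 t := by
        refine ((hasDerivAt_id t).sub_const t1).congr_of_eventuallyEq ?_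
        filter_upwards [Ioi_mem_nhds h] with τ hτ
        exact max_eq_left (sub_nonneg.2 (le_of_lt hτ))
      have eθ : HasDerivAt θ 0 t := by
        have := (em.const_mul umax).const_add θ0
        rw [mul_zero] at this
        exact this
      have eφ : θ t = φ := by
        have : m t = t1 := min_eq_right h.le
        simp only [θ]; rw [this, ht1e]; ring
      rw [if_neg (not_lt.2 h.le)]
      refine ⟨HasDerivAt.hasDerivWithinAt ?_, HasDerivAt.hasDerivWithinAt ?_,
        eθ.hasDerivWithinAt⟩
      · convert! ((eθ.sin.const_mul r).const_add (x0 - r * Real.sin θ0)).add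
          (eM.const_mul (vmin * Real.cos φ)) using 1
        rw [eφ]; ring
      · convert! ((eθ.cos.const_mul r).const_sub (y0 + r * Real.cos θ0)).add
          (eM.const_mul (vmin * Real.sin φ)) using 1
        rw [eφ]; ring
  · have e1 : m 0 = 0 := min_eq_left ht10
    have e2 : M 0 = 0 := max_eq_right (by linarith)
    simp [x, y, θ, e1, e2]
  · have e2 : M (t1 + t2) = t2 := by
      simp only [M]; rw [add_sub_cancel_left]; exact max_eq_left ht20
    simp only [x]; rw [e2]
    linear_combination hc1 + Real.cos φ * ht2e
  · have e2 : M (t1 + t2) = t2 := by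
      simp only [M]; rw [add_sub_cancel_left]; exact max_eq_left ht20
    simp only [y]; rw [e2]
    linear_combination hc2 + Real.sin φ * ht2e

/-- Existence of a time-optimal trajectory to the target circle: the set of admissible
arrival times is nonempty and its infimum is attained. -/
theorem dubins_time_optimal_to_target (umax vmin vmax : ℝ)
    (humax : 0 < umax) (hvmin : 0 < vmin) (hv : vmin ≤ vmax)
    (q₀ : ℝ × ℝ × ℝ) :
    (DubinsReachTimes umax vmin vmax q₀).Nonempty ∧
    sInf (DubinsReachTimes umax vmin vmax q₀) ∈ DubinsReachTimes umax vmin vmax q₀ := by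
  have hne := dubins_nonempty humax hvmin hv q₀
  refine ⟨hne, ?_⟩
  obtain ⟨Tn, _, hT, hTn⟩ := exists_seq_tendsto_sInf hne ⟨0, fun _ h => h.1⟩
  exact dubins_closed humax hvmin hv q₀ hTn hT
end
end

section
/- For the reduced system, let X₀, X₁ ∈ ℝ² and suppose that there exists some T ≥ 0 and an admissible trajectory on [0,T] joining X₀ to X₁. Then the infimum T* of the set {T ≥ 0 : some admissible trajectory on [0,T] joins X₀ to X₁} is attained: there is an admissible trajectory on [0,T*] joining X₀ to X₁ (existence of time-optimal trajectories). -/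
open MeasureTheory Set

noncomputable section

/-- An admissible pair of the reduced system on `[t0, t1]`: a measurable control
`(u, v)` with values in `[-1,1] × [ν,η]` together with a Lipschitz curve
`q = (x, y)` satisfying `x' = -v - u y`, `y' = u x` a.e. -/
def ReducedAdm (ν η t0 t1 : ℝ) (q : ℝ → ℝ × ℝ) (u v : ℝ → ℝ) : Prop :=
  Measurable u ∧ Measurable v ∧
  (∀ᵐ t ∂volume, t ∈ Icc t0 t1 → u t ∈ Icc (-1 : ℝ) 1 ∧ v t ∈ Icc ν η) ∧
  (∃ K, LipschitzOnWith K q (Icc t0 t1)) ∧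
  (∀ᵐ t ∂volume, t ∈ Icc t0 t1 →
    HasDerivWithinAt q (-(v t) - u t * (q t).2, u t * (q t).1) (Icc t0 t1) t)

/-- The set of times `T ≥ 0` such that some admissible trajectory of the reduced
system joins `X₀` to `X₁` in time `T`. -/
def ReducedReachTimes (ν η : ℝ) (X₀ X₁ : ℝ × ℝ) : Set ℝ :=
  {T | 0 ≤ T ∧ ∃ q u v, ReducedAdm ν η 0 T q u v ∧ q 0 = X₀ ∧ q T = X₁}


open Filter Topology intervalIntegral
open scoped Interval

lemma ftc_aux {T : ℝ} (f D : ℝ → ℝ) (hT : 0 ≤ T)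
    (hf : AbsolutelyContinuousOnInterval f 0 T)
    (hD : ∀ᵐ t ∂volume, t ∈ Icc 0 T → HasDerivWithinAt f (D t) (Icc 0 T) t)
    {s t : ℝ} (hs : s ∈ Icc 0 T) (ht : t ∈ Icc 0 T) :
    IntervalIntegrable D volume t s ∧ ∫ r in t..s, D r = f s - f t := by
  have hsub : uIcc t s ⊆ Icc 0 T := uIcc_subset_Icc ht hs
  have hac : AbsolutelyContinuousOnInterval f t s := hf.mono (by rwa [uIcc_of_le hT])
  have hae : ∀ᵐ r ∂volume, r ∈ Ι t s → deriv f r = D r := by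
    have h0 : ∀ᵐ r : ℝ ∂volume, r ≠ 0 := by simp [ae_iff]
    have h1 : ∀ᵐ r : ℝ ∂volume, r ≠ T := by simp [ae_iff]
    filter_upwards [hD, h0, h1] with r hr hr0 hr1 hrm
    have hm := hsub (uIoc_subset_uIcc hrm)
    have : Icc 0 T ∈ 𝓝 r :=
      Icc_mem_nhds (lt_of_le_of_ne hm.1 (Ne.symm hr0)) (lt_of_le_of_ne hm.2 hr1)
    exact ((hr hm).hasDerivAt this).deriv
  constructor
  · refine hac.intervalIntegrable_deriv.congr_ae ?_
    exact (ae_restrict_iff' measurableSet_uIoc).2 hae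
  · rw [← hac.integral_deriv_eq_sub]
    exact (intervalIntegral.integral_congr_ae hae).symm

/-- Pointwise closed conditions characterising trajectories. -/
structure Good (ν η T L : ℝ) (θ V x y : ℝ → ℝ) : Prop where
  th1 : ∀ t ∈ Icc 0 T, ∀ s ∈ Icc 0 T, t ≤ s → -1 * (s - t) ≤ θ s - θ t ∧ θ s - θ t ≤ 1 * (s - t)
  V1 : ∀ t ∈ Icc 0 T, ∀ s ∈ Icc 0 T, t ≤ s → ν * (s - t) ≤ V s - V t ∧ V s - V t ≤ η * (s - t)
  xL : ∀ t ∈ Icc 0 T, ∀ s ∈ Icc 0 T, |x s - x t| ≤ L * |s - t|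
  yL : ∀ t ∈ Icc 0 T, ∀ s ∈ Icc 0 T, |y s - y t| ≤ L * |s - t|
  xE : ∀ t ∈ Icc 0 T, ∀ s ∈ Icc 0 T,
    |x s - x t + (V s - V t) + y t * (θ s - θ t)| ≤ L * |s - t| * |s - t|
  yE : ∀ t ∈ Icc 0 T, ∀ s ∈ Icc 0 T,
    |y s - y t - x t * (θ s - θ t)| ≤ L * |s - t| * |s - t|

lemma slope_aux {T c d D t : ℝ} {f : ℝ → ℝ} (ht : t ∈ Ioo 0 T)
    (h : ∀ t ∈ Icc 0 T, ∀ s ∈ Icc 0 T, t ≤ s → c * (s - t) ≤ f s - f t ∧ f s - f t ≤ d * (s - t))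
    (hD : HasDerivAt f D t) : D ∈ Icc c d := by
  have h1 := hD.hasDerivWithinAt (s := Ioi t)
  rw [hasDerivWithinAt_iff_tendsto_slope' (by simp)] at h1
  have hev : ∀ᶠ s in 𝓝[>] t, c ≤ slope f t s ∧ slope f t s ≤ d := by
    filter_upwards [Ioo_mem_nhdsGT ht.2] with s hs
    have := h t ⟨ht.1.le, ht.2.le⟩ s ⟨(ht.1.trans hs.1).le, hs.2.le⟩ hs.1.le
    have hp : 0 < s - t := sub_pos.2 hs.1
    rw [slope_def_field, le_div_iff₀ hp, div_le_iff₀ hp]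
    exact this
  exact ⟨ge_of_tendsto h1 (hev.mono fun _ h => h.1), le_of_tendsto h1 (hev.mono fun _ h => h.2)⟩

lemma lip_of_abs {T L : ℝ} {f : ℝ → ℝ}
    (h : ∀ t ∈ Icc 0 T, ∀ s ∈ Icc 0 T, |f s - f t| ≤ L * |s - t|) :
    LipschitzOnWith (Real.toNNReal L) f (Icc 0 T) := by
  refine LipschitzOnWith.of_dist_le_mul fun s hs t ht => ?_
  rw [Real.dist_eq, Real.dist_eq]
  exact (h t ht s hs).trans (mul_le_mul_of_nonneg_right (Real.le_coe_toNNReal L) (abs_nonneg _))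

lemma abs_of_slope {T c d L : ℝ} {f : ℝ → ℝ} (hc : -L ≤ c) (hd : d ≤ L)
    (h : ∀ t ∈ Icc 0 T, ∀ s ∈ Icc 0 T, t ≤ s → c * (s - t) ≤ f s - f t ∧ f s - f t ≤ d * (s - t)) :
    ∀ t ∈ Icc 0 T, ∀ s ∈ Icc 0 T, |f s - f t| ≤ L * |s - t| := by
  have key : ∀ t ∈ Icc 0 T, ∀ s ∈ Icc 0 T, t ≤ s → |f s - f t| ≤ L * |s - t| := by
    intro t ht s hs hts
    have := h t ht s hs hts
    have hp : 0 ≤ s - t := sub_nonneg.2 hts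
    rw [abs_of_nonneg hp, abs_le]
    constructor <;> nlinarith
  intro t ht s hs
  rcases le_total t s with h' | h'
  · exact key t ht s hs h'
  · rw [abs_sub_comm, abs_sub_comm s]
    exact key s hs t ht h'

lemma rem_aux {T L t : ℝ} {r : ℝ → ℝ} (ht : t ∈ Ioo 0 T) 
    (h : ∀ s ∈ Icc 0 T, |r s| ≤ L * |s - t| * |s - t|) : HasDerivAt r 0 t := by
  have hnb : Icc 0 T ∈ 𝓝 t := Icc_mem_nhds ht.1 ht.2
  have h0 : r t = 0 := by
    have := h t ⟨ht.1.le, ht.2.le⟩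
    simpa using this
  rw [hasDerivAt_iff_isLittleO]
  have hO : (fun s => r s - r t - (s - t) • (0:ℝ)) =O[𝓝 t] fun s => (s - t) * (s - t) := by
    refine Asymptotics.IsBigO.of_bound L ?_
    filter_upwards [hnb] with s hs
    simpa [h0, abs_mul, mul_assoc] using h s hs
  refine hO.trans_isLittleO ?_
  have h2 : (fun s : ℝ => s - t) =o[𝓝 t] fun _ => (1:ℝ) := by
    rw [Asymptotics.isLittleO_one_iff]
    have : Tendsto (fun s : ℝ => s - t) (𝓝 t) (𝓝 (t - t)) := tendsto_id.sub_const t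
    simpa using this
  simpa using h2.mul_isBigO (Asymptotics.isBigO_refl (fun s : ℝ => s - t) (𝓝 t))

lemma adm_of_good {ν η T L : ℝ} (hν : 0 < ν) (hνη : ν ≤ η) {θ V x y : ℝ → ℝ}
    (h : Good ν η T L θ V x y) :
    ReducedAdm ν η 0 T (fun t => (x t, y t)) (deriv θ) (deriv V) := by
  have dθ := (lip_of_abs (abs_of_slope le_rfl le_rfl h.th1)).ae_differentiableWithinAt_of_mem
    (μ := volume)
  have dV := (lip_of_abs (abs_of_slope (by linarith : -η ≤ ν) le_rfl
    h.V1)).ae_differentiableWithinAt_of_mem (μ := volume)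
  have h0 : ∀ᵐ r : ℝ ∂volume, r ≠ 0 := by simp [ae_iff]
  have h1 : ∀ᵐ r : ℝ ∂volume, r ≠ T := by simp [ae_iff]
  have key : ∀ᵐ t : ℝ ∂volume, t ∈ Icc 0 T → t ∈ Ioo 0 T ∧ HasDerivAt θ (deriv θ t) t ∧
      HasDerivAt V (deriv V t) t := by
    filter_upwards [dθ, dV, h0, h1] with t h1 h2 h3 h4 ht
    have hm : t ∈ Ioo 0 T := ⟨lt_of_le_of_ne ht.1 (Ne.symm h3), lt_of_le_of_ne ht.2 h4⟩
    have hn := Icc_mem_nhds hm.1 hm.2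
    exact ⟨hm, ((h1 ht).differentiableAt hn).hasDerivAt, ((h2 ht).differentiableAt hn).hasDerivAt⟩
  refine ⟨measurable_deriv _, measurable_deriv _, ?_, ?_, ?_⟩
  · filter_upwards [key] with t hk ht
    obtain ⟨hm, a, b⟩ := hk ht
    exact ⟨slope_aux hm h.th1 a, slope_aux hm h.V1 b⟩
  · exact ⟨_, (lip_of_abs h.xL).prodMk (lip_of_abs h.yL)⟩
  · filter_upwards [key] with t hk ht
    obtain ⟨hm, a, b⟩ := hk ht
    refine HasDerivAt.hasDerivWithinAt ?_
    have rx := rem_aux hm (h.xE t ht)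
    have ry := rem_aux hm (h.yE t ht)
    have hx : HasDerivAt x (-(deriv V t) - deriv θ t * y t) t := by
      have := (rx.sub (b.sub_const (V t))).sub ((a.sub_const (θ t)).const_mul (y t)) |>.add_const (x t)
      exact (this.congr_deriv (by ring)).congr_of_eventuallyEq
        (Eventually.of_forall fun s => by simp; ring)
    have hy : HasDerivAt y (deriv θ t * x t) t := by
      have := (ry.add ((a.sub_const (θ t)).const_mul (x t))).add_const (y t)
      exact (this.congr_deriv (by ring)).congr_of_eventuallyEq
        (Eventually.of_forall fun s => by simp)
    exact hx.prodMk hy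

lemma bound_aux {a c r : ℝ} (ha : 0 ≤ a) (hc : 0 ≤ c) (hr : 0 ≤ r) (h : r ^ 2 ≤ a + c * r) :
    r ≤ a + c + 1 := by
  by_contra hlt
  push Not at hlt
  nlinarith

lemma good_of_adm {ν η T T1 : ℝ} (hν : 0 < ν) (hνη : ν ≤ η) (hT : 0 ≤ T) (hT1 : T ≤ T1)
    {q : ℝ → ℝ × ℝ} {u v : ℝ → ℝ} {X₀ : ℝ × ℝ} (h : ReducedAdm ν η 0 T q u v) (h0 : q 0 = X₀) :
    Good ν η T (η + (X₀.1 ^ 2 + X₀.2 ^ 2 + 2 * η * T1 + 1)) (fun t => ∫ r in (0:ℝ)..t, u r)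
      (fun t => ∫ r in (0:ℝ)..t, v r) (fun t => (q t).1) (fun t => (q t).2) := by
  obtain ⟨hu, hv, hc, ⟨K, hK⟩, hd⟩ := h
  have hη : 0 < η := hν.trans_le hνη
  have zm : (0:ℝ) ∈ Icc 0 T := ⟨le_rfl, hT⟩
  have lx : LipschitzOnWith (1 * K) (fun t => (q t).1) (Icc 0 T) :=
    LipschitzWith.prod_fst.comp_lipschitzOnWith hK
  have ly : LipschitzOnWith (1 * K) (fun t => (q t).2) (Icc 0 T) :=
    LipschitzWith.prod_snd.comp_lipschitzOnWith hK
  rw [← uIcc_of_le hT] at lx ly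
  have ax := lx.absolutelyContinuousOnInterval
  have ay := ly.absolutelyContinuousOnInterval
  rw [uIcc_of_le hT] at lx ly
  have dx : ∀ᵐ t ∂volume, t ∈ Icc 0 T →
      HasDerivWithinAt (fun t => (q t).1) (-(v t) - u t * (q t).2) (Icc 0 T) t := by
    filter_upwards [hd] with t h ht
    exact (hasFDerivAt_fst (𝕜 := ℝ) (p := q t)).comp_hasDerivWithinAt t (h ht)
  have dy : ∀ᵐ t ∂volume, t ∈ Icc 0 T →
      HasDerivWithinAt (fun t => (q t).2) (u t * (q t).1) (Icc 0 T) t := by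
    filter_upwards [hd] with t h ht
    exact (hasFDerivAt_snd (𝕜 := ℝ) (p := q t)).comp_hasDerivWithinAt t (h ht)
  set B := X₀.1 ^ 2 + X₀.2 ^ 2 + 2 * η * T1 + 1 with hB
  have hB0 : 0 < B := by
    have := mul_nonneg (mul_nonneg zero_le_two hη.le) (hT.trans hT1)
    positivity
  -- a priori bound
  have bd : ∀ t ∈ Icc 0 T, |(q t).1| ≤ B ∧ |(q t).2| ≤ B := by
    have aw := (ax.mul ax).add (ay.mul ay)
    have cw : ContinuousOn (fun t => (q t).1 ^ 2 + (q t).2 ^ 2) (Icc 0 T) :=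
      (lx.continuousOn.pow 2).add (ly.continuousOn.pow 2)
    obtain ⟨t0, ht0, hmax⟩ := isCompact_Icc.exists_isMaxOn ⟨0, zm⟩ cw
    have hmax' : ∀ t ∈ Icc 0 T, (q t).1 ^ 2 + (q t).2 ^ 2 ≤ (q t0).1 ^ 2 + (q t0).2 ^ 2 :=
      fun t ht => hmax ht
    set m := (q t0).1 ^ 2 + (q t0).2 ^ 2 with hm
    have hm0 : 0 ≤ m := by positivity
    have hsq : Real.sqrt m ^ 2 = m := Real.sq_sqrt hm0
    have hx : ∀ t ∈ Icc 0 T, |(q t).1| ≤ Real.sqrt m ∧ |(q t).2| ≤ Real.sqrt m := by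
      intro t ht
      have := hmax' t ht
      exact ⟨Real.abs_le_sqrt (by nlinarith), Real.abs_le_sqrt (by nlinarith)⟩
    have ftc := (ftc_aux _ (fun t => 2 * (-(v t) * (q t).1)) hT aw (by
      filter_upwards [dx, dy] with t h1 h2 ht
      have := ((h1 ht).mul (h1 ht)).add ((h2 ht).mul (h2 ht))
      exact this.congr_deriv (by ring)) ht0 zm).2
    have hle := norm_integral_le_of_norm_le_const_ae (a := 0) (b := t0)
      (f := fun t => 2 * (-(v t) * (q t).1)) (C := 2 * (η * Real.sqrt m)) (by
        filter_upwards [hc] with t h1 ht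
        have hti : t ∈ Icc 0 T := uIcc_subset_Icc zm ht0 (uIoc_subset_uIcc ht)
        have h2 := (h1 hti).2
        rw [norm_mul, norm_mul, norm_neg, Real.norm_eq_abs, Real.norm_eq_abs, Real.norm_eq_abs,
          abs_two, abs_of_nonneg (hν.le.trans h2.1)]
        have := (hx t hti).1
        have := mul_le_mul h2.2 this (abs_nonneg _) hη.le
        linarith)
    rw [ftc, Real.norm_eq_abs, sub_zero, abs_of_nonneg ht0.1] at hle
    have hle' := (le_abs_self _).trans hle
    simp only [Pi.add_apply, Pi.mul_apply, h0] at hle'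
    have h3 : 2 * (η * Real.sqrt m) * t0 ≤ 2 * (η * Real.sqrt m) * T1 :=
      mul_le_mul_of_nonneg_left (ht0.2.trans hT1) (by positivity)
    have h4 := bound_aux (a := X₀.1 ^ 2 + X₀.2 ^ 2) (c := 2 * η * T1) (r := Real.sqrt m)
      (by positivity) (mul_nonneg (mul_nonneg zero_le_two hη.le) (hT.trans hT1))
      (Real.sqrt_nonneg _) (by rw [hsq, hm]; nlinarith)
    intro t ht
    exact ⟨(hx t ht).1.trans h4, (hx t ht).2.trans h4⟩
  -- integrability
  have iu : ∀ t ∈ Icc 0 T, ∀ s ∈ Icc 0 T, IntervalIntegrable u volume t s := by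
    intro t ht s hs
    refine (intervalIntegrable_const (c := (1:ℝ))).mono_fun hu.aestronglyMeasurable ?_
    rw [EventuallyLE, ae_restrict_iff' measurableSet_uIoc]
    filter_upwards [hc] with r h1 hr
    have := (h1 (uIcc_subset_Icc ht hs (uIoc_subset_uIcc hr))).1
    simpa [abs_le] using this
  have iv : ∀ t ∈ Icc 0 T, ∀ s ∈ Icc 0 T, IntervalIntegrable v volume t s := by
    intro t ht s hs
    refine (intervalIntegrable_const (c := (η:ℝ))).mono_fun hv.aestronglyMeasurable ?_
    rw [EventuallyLE, ae_restrict_iff' measurableSet_uIoc]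
    filter_upwards [hc] with r h1 hr
    have := (h1 (uIcc_subset_Icc ht hs (uIoc_subset_uIcc hr))).2
    rw [Real.norm_eq_abs, Real.norm_eq_abs, abs_of_pos hη, abs_of_nonneg (hν.le.trans this.1)]
    exact this.2
  have eu : ∀ t ∈ Icc 0 T, ∀ s ∈ Icc 0 T,
      (∫ r in (0:ℝ)..s, u r) - (∫ r in (0:ℝ)..t, u r) = ∫ r in t..s, u r := fun t ht s hs =>
    integral_interval_sub_left (iu 0 zm s hs) (iu 0 zm t ht)
  have ev : ∀ t ∈ Icc 0 T, ∀ s ∈ Icc 0 T,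
      (∫ r in (0:ℝ)..s, v r) - (∫ r in (0:ℝ)..t, v r) = ∫ r in t..s, v r := fun t ht s hs =>
    integral_interval_sub_left (iv 0 zm s hs) (iv 0 zm t ht)
  have mono : ∀ (w : ℝ → ℝ) (a b : ℝ), (∀ t ∈ Icc 0 T, ∀ s ∈ Icc 0 T, IntervalIntegrable w volume t s) →
      (∀ᵐ t ∂volume, t ∈ Icc 0 T → w t ∈ Icc a b) → ∀ t ∈ Icc 0 T, ∀ s ∈ Icc 0 T, t ≤ s →
      a * (s - t) ≤ ∫ r in t..s, w r ∧ ∫ r in t..s, w r ≤ b * (s - t) := by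
    intro w a b hw hab t ht s hs hts
    have hab' : ∀ᵐ r ∂(volume.restrict (Icc t s)), w r ∈ Icc a b := by
      rw [ae_restrict_iff' measurableSet_Icc]
      filter_upwards [hab] with r hr hrm
      exact hr ⟨ht.1.trans hrm.1, hrm.2.trans hs.2⟩
    have h1 := integral_mono_ae_restrict hts (intervalIntegrable_const (c := a)) (hw t ht s hs)
      (hab'.mono fun _ h => h.1)
    have h2 := integral_mono_ae_restrict hts (hw t ht s hs) (intervalIntegrable_const (c := b))
      (hab'.mono fun _ h => h.2)
    simp only [intervalIntegral.integral_const, smul_eq_mul] at h1 h2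
    constructor <;> linarith
  have xL : ∀ t ∈ Icc 0 T, ∀ s ∈ Icc 0 T, |(q s).1 - (q t).1| ≤ (η + B) * |s - t| := by
    intro t ht s hs
    rw [← (ftc_aux _ _ hT ax dx hs ht).2, ← Real.norm_eq_abs]
    refine norm_integral_le_of_norm_le_const_ae ?_
    filter_upwards [hc] with r h1 hr
    have hri := uIcc_subset_Icc ht hs (uIoc_subset_uIcc hr)
    obtain ⟨hu1, hv1⟩ := h1 hri
    have h2 : |u r * (q r).2| ≤ 1 * B := by
      rw [abs_mul]
      exact mul_le_mul (abs_le.2 hu1) (bd r hri).2 (abs_nonneg _) zero_le_one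
    have h3 := abs_le.1 h2
    rw [Real.norm_eq_abs, abs_le]
    constructor <;> linarith [hv1.1, hv1.2]
  have yL : ∀ t ∈ Icc 0 T, ∀ s ∈ Icc 0 T, |(q s).2 - (q t).2| ≤ (η + B) * |s - t| := by
    intro t ht s hs
    rw [← (ftc_aux _ _ hT ay dy hs ht).2, ← Real.norm_eq_abs]
    refine norm_integral_le_of_norm_le_const_ae ?_
    filter_upwards [hc] with r h1 hr
    have hri := uIcc_subset_Icc ht hs (uIoc_subset_uIcc hr)
    obtain ⟨hu1, hv1⟩ := h1 hri
    rw [Real.norm_eq_abs, abs_mul]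
    have := mul_le_mul (abs_le.2 hu1) (bd r hri).1 (abs_nonneg _) zero_le_one
    linarith
  have est : ∀ (z : ℝ → ℝ), (∀ t ∈ Icc 0 T, ∀ s ∈ Icc 0 T, |z s - z t| ≤ (η + B) * |s - t|) →
      ∀ t ∈ Icc 0 T, ∀ s ∈ Icc 0 T,
      |∫ r in t..s, u r * (z r - z t)| ≤ (η + B) * |s - t| * |s - t| := by
    intro z hz t ht s hs
    rw [← Real.norm_eq_abs]
    refine norm_integral_le_of_norm_le_const_ae ?_
    filter_upwards [hc] with r h1 hr
    have hru := uIoc_subset_uIcc hr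
    have hri := uIcc_subset_Icc ht hs hru
    obtain ⟨hu1, hv1⟩ := h1 hri
    rw [Real.norm_eq_abs, abs_mul]
    have h2 := mul_le_mul (abs_le.2 hu1) (hz t ht r hri) (abs_nonneg _) zero_le_one
    have h3 : |r - t| ≤ |s - t| := abs_sub_left_of_mem_uIcc hru
    have h4 := mul_le_mul_of_nonneg_left h3 (add_nonneg hη.le hB0.le)
    linarith
  refine ⟨?_, ?_, xL, yL, ?_, ?_⟩
  · intro t ht s hs hts
    rw [eu t ht s hs]
    exact mono u _ _ iu (hc.mono fun _ h h' => (h h').1) t ht s hs hts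
  · intro t ht s hs hts
    rw [ev t ht s hs]
    exact mono v _ _ iv (hc.mono fun _ h h' => (h h').2) t ht s hs hts
  · intro t ht s hs
    have e1 := est _ yL t ht s hs
    obtain ⟨i1, e2⟩ := ftc_aux _ _ hT ax dx hs ht
    rw [eu t ht s hs, ev t ht s hs, ← e2, ← intervalIntegral.integral_const_mul,
      ← integral_add i1 (iv t ht s hs),
      ← integral_add (i1.add (iv t ht s hs)) ((iu t ht s hs).const_mul _), ← abs_neg,
      ← intervalIntegral.integral_neg]
    convert e1 using 2
    refine integral_congr fun r _ => ?_
    ring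
  · intro t ht s hs
    have e1 := est _ xL t ht s hs
    obtain ⟨i1, e2⟩ := ftc_aux _ _ hT ay dy hs ht
    rw [eu t ht s hs, ← e2, ← intervalIntegral.integral_const_mul,
      ← integral_sub i1 ((iu t ht s hs).const_mul _)]
    convert e1 using 2
    refine integral_congr fun r _ => ?_
    ring

lemma ulim_aux (a : ℕ → ℝ) (M : ℝ) (h : ∀ n, |a n| ≤ M) :
    ∃ l, Tendsto a (hyperfilter ℕ : Filter ℕ) (𝓝 l) := by
  have hc : IsCompact (Icc (-M) M) := isCompact_Icc
  rw [isCompact_iff_ultrafilter_le_nhds] at hc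
  obtain ⟨l, -, hl⟩ := hc ((hyperfilter ℕ).map a) (by
    rw [le_principal_iff]
    exact Filter.mem_map.2 (Filter.univ_mem' fun n => abs_le.1 (h n)))
  exact ⟨l, hl⟩

lemma ulim_fun {T L c : ℝ} (hT : 0 ≤ T) (hL : 0 ≤ L) (f : ℕ → ℝ → ℝ) (h0 : ∀ n, f n 0 = c)
    (h : ∀ n, ∀ t ∈ Icc 0 T, ∀ s ∈ Icc 0 T, |f n s - f n t| ≤ L * |s - t|) :
    ∃ g : ℝ → ℝ, ∀ t ∈ Icc 0 T, Tendsto (fun n => f n t) (hyperfilter ℕ : Filter ℕ) (𝓝 (g t)) := by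
  have : ∀ t, ∃ l, t ∈ Icc 0 T → Tendsto (fun n => f n t) (hyperfilter ℕ : Filter ℕ) (𝓝 l) := by
    intro t
    by_cases ht : t ∈ Icc 0 T
    · obtain ⟨l, hl⟩ := ulim_aux (fun n => f n t) (|c| + L * T) (by
        intro n
        have h1 := h n 0 ⟨le_rfl, hT⟩ t ht
        rw [h0, sub_zero, abs_of_nonneg ht.1] at h1
        have h2 := mul_le_mul_of_nonneg_left ht.2 hL
        have h3 := abs_add_le (f n t - c) c
        rw [sub_add_cancel] at h3
        linarith)
      exact ⟨l, fun _ => hl⟩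
    · exact ⟨0, fun h => absurd h ht⟩
  choose g hg using this
  exact ⟨g, hg⟩

/-- Existence of time-optimal trajectories for the reduced system: if `X₁` is
reachable from `X₀`, then the infimum of reaching times is attained. -/
theorem reduced_time_optimal_exists (ν η : ℝ) (hν : 0 < ν) (hνη : ν ≤ η)
    (X₀ X₁ : ℝ × ℝ) (hreach : (ReducedReachTimes ν η X₀ X₁).Nonempty) :
    sInf (ReducedReachTimes ν η X₀ X₁) ∈ ReducedReachTimes ν η X₀ X₁ := by
  set S := ReducedReachTimes ν η X₀ X₁ with hS
  set T := sInf S with hTdef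
  have hη : 0 < η := hν.trans_le hνη
  have hT : 0 ≤ T := Real.sInf_nonneg fun t ht => ht.1
  have hbdd : BddBelow S := ⟨0, fun t ht => ht.1⟩
  set L := η + (X₀.1 ^ 2 + X₀.2 ^ 2 + 2 * η * (T + 1) + 1) with hL
  have hL0 : 0 ≤ L := by positivity
  have hLη : η ≤ L := by
    have : 0 ≤ X₀.1 ^ 2 + X₀.2 ^ 2 + 2 * η * (T + 1) + 1 := by positivity
    linarith
  have hseq : ∀ n : ℕ, ∃ θ V x y : ℝ → ℝ, Good ν η T L θ V x y ∧ θ 0 = 0 ∧ V 0 = 0 ∧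
      x 0 = X₀.1 ∧ y 0 = X₀.2 ∧ |x T - X₁.1| ≤ L * (1 / ((n : ℝ) + 1)) ∧
      |y T - X₁.2| ≤ L * (1 / ((n : ℝ) + 1)) := by
    intro n
    have hpos : (0:ℝ) < 1 / ((n : ℝ) + 1) := by positivity
    have hle1 : 1 / ((n : ℝ) + 1) ≤ 1 := by
      rw [div_le_one (by positivity)]
      linarith [Nat.cast_nonneg (α := ℝ) n]
    obtain ⟨T', hT', hlt⟩ := Real.lt_sInf_add_pos hreach hpos
    have hTT' : T ≤ T' := csInf_le hbdd hT'
    obtain ⟨hT'0, q, u, v, hadm, hq0, hq1⟩ := hT'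
    have hlt' : T' < T + 1 / ((n : ℝ) + 1) := hlt
    have hg := good_of_adm (T1 := T + 1) hν hνη hT'0 (by linarith) hadm hq0
    have hsub : ∀ t ∈ Icc 0 T, t ∈ Icc 0 T' := fun t ht => ⟨ht.1, ht.2.trans hTT'⟩
    have hTm : T ∈ Icc 0 T' := ⟨hT, hTT'⟩
    have hTm' : T' ∈ Icc 0 T' := ⟨hT'0, le_rfl⟩
    have hab : L * |T - T'| ≤ L * (1 / ((n : ℝ) + 1)) := by
      refine mul_le_mul_of_nonneg_left ?_ hL0
      rw [abs_sub_comm, abs_of_nonneg (sub_nonneg.2 hTT')]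
      linarith
    refine ⟨fun t => ∫ r in (0:ℝ)..t, u r, fun t => ∫ r in (0:ℝ)..t, v r, fun t => (q t).1, fun t => (q t).2, ⟨?_, ?_, ?_, ?_, ?_, ?_⟩, integral_same, integral_same,
      congrArg Prod.fst hq0, congrArg Prod.snd hq0, ?_, ?_⟩
    · exact fun t ht s hs => hg.th1 t (hsub t ht) s (hsub s hs)
    · exact fun t ht s hs => hg.V1 t (hsub t ht) s (hsub s hs)
    · exact fun t ht s hs => hg.xL t (hsub t ht) s (hsub s hs)
    · exact fun t ht s hs => hg.yL t (hsub t ht) s (hsub s hs)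
    · exact fun t ht s hs => hg.xE t (hsub t ht) s (hsub s hs)
    · exact fun t ht s hs => hg.yE t (hsub t ht) s (hsub s hs)
    · have := hg.xL T' hTm' T hTm
      simp only [hq1] at this
      exact this.trans hab
    · have := hg.yL T' hTm' T hTm
      simp only [hq1] at this
      exact this.trans hab
  choose θ V x y hG hθ0 hV0 hx0 hy0 hx1 hy1 using hseq
  obtain ⟨θ', lθ⟩ := ulim_fun hT zero_le_one θ hθ0
    (fun n => abs_of_slope le_rfl le_rfl (hG n).th1)
  obtain ⟨V', lV⟩ := ulim_fun hT hη.le V hV0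
    (fun n => abs_of_slope (by linarith : -η ≤ ν) le_rfl (hG n).V1)
  obtain ⟨x', lx⟩ := ulim_fun hT hL0 x hx0 (fun n => (hG n).xL)
  obtain ⟨y', ly⟩ := ulim_fun hT hL0 y hy0 (fun n => (hG n).yL)
  have hgood : Good ν η T L θ' V' x' y' := by
    refine ⟨?_, ?_, ?_, ?_, ?_, ?_⟩
    · intro t ht s hs hts
      have := (lθ s hs).sub (lθ t ht)
      exact ⟨ge_of_tendsto' this fun n => ((hG n).th1 t ht s hs hts).1,
        le_of_tendsto' this fun n => ((hG n).th1 t ht s hs hts).2⟩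
    · intro t ht s hs hts
      have := (lV s hs).sub (lV t ht)
      exact ⟨ge_of_tendsto' this fun n => ((hG n).V1 t ht s hs hts).1,
        le_of_tendsto' this fun n => ((hG n).V1 t ht s hs hts).2⟩
    · exact fun t ht s hs => le_of_tendsto' ((lx s hs).sub (lx t ht)).abs
        fun n => (hG n).xL t ht s hs
    · exact fun t ht s hs => le_of_tendsto' ((ly s hs).sub (ly t ht)).abs
        fun n => (hG n).yL t ht s hs
    · exact fun t ht s hs => le_of_tendsto' ((((lx s hs).sub (lx t ht)).add
        ((lV s hs).sub (lV t ht))).add ((ly t ht).mul ((lθ s hs).sub (lθ t ht)))).abs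
        fun n => (hG n).xE t ht s hs
    · exact fun t ht s hs => le_of_tendsto' (((ly s hs).sub (ly t ht)).sub
        ((lx t ht).mul ((lθ s hs).sub (lθ t ht)))).abs
        fun n => (hG n).yE t ht s hs
  have zm : (0:ℝ) ∈ Icc 0 T := ⟨le_rfl, hT⟩
  have Tm : T ∈ Icc 0 T := ⟨hT, le_rfl⟩
  have hlim : Tendsto (fun n : ℕ => L * (1 / ((n : ℝ) + 1))) (hyperfilter ℕ : Filter ℕ) (𝓝 0) := by
    have := (tendsto_one_div_add_atTop_nhds_zero_nat (𝕜 := ℝ)).const_mul L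
    rw [mul_zero] at this
    exact this.mono_left Nat.hyperfilter_le_atTop
  have endp : ∀ (z : ℕ → ℝ → ℝ) (z' : ℝ → ℝ) (c : ℝ),
      Tendsto (fun n => z n T) (hyperfilter ℕ : Filter ℕ) (𝓝 (z' T)) →
      (∀ n : ℕ, |z n T - c| ≤ L * (1 / ((n : ℝ) + 1))) → z' T = c := by
    intro z z' c hz hb
    have := le_of_tendsto_of_tendsto' (hz.sub_const c).abs hlim hb
    exact sub_eq_zero.1 (abs_nonpos_iff.1 this)
  refine ⟨hT, _, _, _, adm_of_good hν hνη hgood, ?_, ?_⟩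
  · refine Prod.ext ?_ ?_
    · refine tendsto_nhds_unique (lx 0 zm) ?_
      simp only [hx0]
      exact tendsto_const_nhds
    · refine tendsto_nhds_unique (ly 0 zm) ?_
      simp only [hy0]
      exact tendsto_const_nhds
  · exact Prod.ext (endp x x' _ (lx T Tm) hx1) (endp y y' _ (ly T Tm) hy1)
end
end
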